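/- Let p be a prime and let E/F be a finite extension of p-adic fields (finite extensions of ℚ_p) such that F contains a primitive p-th root of unity. If α ∈ O_E^× is a p-primary unit of E, then N_{E/F}(α) is a p-primary unit of F. -/

import Mathlib

set_option synthInstance.maxHeartbeats 1000000
set_option maxHeartbeats 1000000
noncomputable section

namespace PadicStmt

variable (p : ℕ) [Fact p.Prime]

/-- The `ℤ_[p]`-algebra structure on a `ℚ_[p]`-algebra. -/
noncomputable instance zpAlgebra (K : Type) [Field K] [Algebra ℚ_[p] K] :
    Algebra ℤ_[p] K :=
  ((algebraMap ℚ_[p] K).comp (algebraMap ℤ_[p] ℚ_[p])).toAlgebra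

instance zpTower (K : Type) [Field K] [Algebra ℚ_[p] K] :
    IsScalarTower ℤ_[p] ℚ_[p] K :=
  IsScalarTower.of_algebraMap_eq fun _ => rfl

instance zpTower' (K L : Type) [Field K] [Field L] [Algebra ℚ_[p] K] [Algebra ℚ_[p] L]
    [Algebra K L] [IsScalarTower ℚ_[p] K L] : IsScalarTower ℤ_[p] K L :=
  IsScalarTower.of_algebraMap_eq fun x => by
    rw [IsScalarTower.algebraMap_apply ℤ_[p] ℚ_[p] L, IsScalarTower.algebraMap_apply ℚ_[p] K L,
      IsScalarTower.algebraMap_apply ℤ_[p] ℚ_[p] K]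

/-- The ring of integers of a `p`-adic field `K`, i.e. the integral closure of `ℤ_[p]` in `K`. -/
abbrev O (K : Type) [Field K] [Algebra ℚ_[p] K] := integralClosure ℤ_[p] K

/-- The natural map `O_K → O_L` for an extension `L/K` of `p`-adic fields. -/
def intMap (K L : Type) [Field K] [Field L] [Algebra ℚ_[p] K] [Algebra ℚ_[p] L]
    [Algebra K L] [IsScalarTower ℚ_[p] K L] : O p K →+* O p L where
  toFun x := ⟨algebraMap K L x.1, IsIntegral.map (IsScalarTower.toAlgHom ℤ_[p] K L) x.2⟩
  map_one' := Subtype.ext (map_one _)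
  map_mul' x y := Subtype.ext (map_mul _ _ _)
  map_zero' := Subtype.ext (map_zero _)
  map_add' x y := Subtype.ext (map_add _ _ _)

/-- The maximal ideal of the ring of integers of a `p`-adic field, described as the
Jacobson radical of `⊥`. -/
def maxIdeal (K : Type) [Field K] [Algebra ℚ_[p] K] : Ideal (O p K) :=
  (⊥ : Ideal (O p K)).jacobson

/-- `v_K x ≥ n`:  `x` is integral and lies in the `n`-th power of the maximal ideal. -/
def ValGE (K : Type) [Field K] [Algebra ℚ_[p] K] (n : ℕ) (x : K) : Prop :=
  ∃ y : O p K, (y : K) = x ∧ y ∈ (maxIdeal p K) ^ n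

/-- `x : K` is a unit of the ring of integers `O_K`. -/
def IsIntegralUnit (K : Type) [Field K] [Algebra ℚ_[p] K] (x : K) : Prop :=
  ∃ u : (O p K)ˣ, ((u : O p K) : K) = x

/-- `x ∈ U_{n,K}`, the `n`-th unit group: `x` is a unit of `O_K` and `v_K (1 - x) ≥ n`. -/
def InU (K : Type) [Field K] [Algebra ℚ_[p] K] (n : ℕ) (x : K) : Prop :=
  IsIntegralUnit p K x ∧ ValGE p K n (1 - x)

/-- An extension `L/K` of `p`-adic fields is unramified iff `m_K O_L = m_L`
(i.e. the ramification index is `1`; the residue extension is automatically separable). -/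
def IsUnramifiedExt (K L : Type) [Field K] [Field L] [Algebra ℚ_[p] K] [Algebra ℚ_[p] L]
    [Algebra K L] [IsScalarTower ℚ_[p] K L] : Prop :=
  Ideal.map (intMap p K L) (maxIdeal p K) = maxIdeal p L

/-- An extension `L/K` of `p`-adic fields is totally ramified iff its residue degree is `1`,
i.e. `O_L = O_K + m_L`. -/
def IsTotallyRamifiedExt (K L : Type) [Field K] [Field L] [Algebra ℚ_[p] K] [Algebra ℚ_[p] L]
    [Algebra K L] [IsScalarTower ℚ_[p] K L] : Prop :=
  ∀ x : O p L, ∃ y : O p K, x - intMap p K L y ∈ maxIdeal p L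

/-- A witness that `α : K` acquires an `n`-th root in some unramified extension of `K`. -/
structure UnramifiedRootWitness (K : Type) [Field K] [Algebra ℚ_[p] K] (n : ℕ) (α : K) where
  L : Type
  [fieldL : Field L]
  [algQL : Algebra ℚ_[p] L]
  [algKL : Algebra K L]
  [tower : IsScalarTower ℚ_[p] K L]
  [fin : FiniteDimensional ℚ_[p] L]
  β : L
  pow_eq : β ^ n = algebraMap K L α
  unram : IsUnramifiedExt p K L

/-- A unit `α` of `O_K` is `p`-primary if `K(α^{1/p})/K` is unramified, equivalently `α`
admits a `p`-th root in an unramified extension of `K`. -/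
def IsPPrimary (K : Type) [Field K] [Algebra ℚ_[p] K] (α : K) : Prop :=
  IsIntegralUnit p K α ∧ Nonempty (UnramifiedRootWitness p K p α)

end PadicStmt

namespace PadicStmt

/-- If `ζ` is a primitive `p`-th root of unity, then `p` equals `(ζ - 1) ^ (p - 1)` up to a unit. -/
lemma exists_unit_mul_sub_one_pow {R : Type*} [CommRing R] [IsDomain R] {p : ℕ} (hp : p.Prime)
    {ζ : R} (hζ : IsPrimitiveRoot ζ p) : ∃ ε : Rˣ, (p : R) = ε * (ζ - 1) ^ (p - 1) := by
  obtain ⟨n, rfl⟩ : ∃ n, p = n + 1 := ⟨p - 1, by have := hp.pos; omega⟩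
  have key : Associated ((ζ - 1) ^ n) (∏ k ∈ Finset.range n, (ζ ^ (k + 1) - 1)) := by
    rw [← Finset.card_range n, ← Finset.prod_const, Finset.card_range]
    refine Associated.prod _ _ _ fun k hk => ?_
    refine hζ.associated_sub_one_pow_sub_one_of_coprime ?_
    exact Nat.Coprime.symm ((Nat.Prime.coprime_iff_not_dvd hp).2 fun h =>
      absurd (Nat.le_of_dvd (by omega) h) (by have := Finset.mem_range.1 hk; omega))
  obtain ⟨u, hu⟩ := key
  refine ⟨(-1) ^ n * u, ?_⟩
  have := hζ.prod_pow_sub_one_eq_order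
  rw [Nat.cast_add_one, ← this, ← hu]
  simp; ring

lemma exists_add_mul_pow_eq {R : Type*} [CommRing R] {p : ℕ} (hp : p.Prime) {π ε : R}
    (h : (p : R) = ε * π ^ (p - 1)) (x w : R) :
    ∃ c, (x + π * w) ^ p = x ^ p + π ^ p * c := by
  obtain ⟨r, hr⟩ := exists_add_pow_prime_eq hp x (π * w)
  refine ⟨w ^ p + ε * x * w * r, ?_⟩
  rw [hr, h, mul_pow]
  obtain ⟨n, rfl⟩ : ∃ n, p = n + 1 := ⟨p - 1, by have := hp.pos; omega⟩
  simp only [Nat.add_sub_cancel]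
  ring

lemma sub_mem_of_pow_sub_pow_mem {S : Type*} [CommRing S] {p : ℕ} (hp : p.Prime) (I : Ideal S)
    [hI : I.IsPrime] (hpI : (p : S) ∈ I) {a b : S} (h : a ^ p - b ^ p ∈ I) : a - b ∈ I := by
  obtain ⟨r, hr⟩ := exists_add_pow_prime_eq hp (a - b) b
  rw [sub_add_cancel] at hr
  refine hI.mem_of_pow_mem p ?_
  have : (a - b) ^ p = (a ^ p - b ^ p) - p * ((a - b) * b * r) := by rw [hr]; ring
  rw [this]
  exact I.sub_mem h (I.mul_mem_right _ hpI)

/-- Let `S/R` be an extension of local rings with the same uniformizer `ϖ`, such that the residue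
field of `R` is perfect.  If `β : S` has its `p`-th power in `R`, then `β` is congruent to an
element of `R` modulo every power of `ϖ` dividing `π`, where `p` is `π ^ (p - 1)` up to a unit. -/
lemma exists_eq_add_mul_of_pow_eq {R S : Type*} [CommRing R] [CommRing S] [IsDomain S]
    (φ : R →+* S) {p : ℕ} (hp : p.Prime) (ϖ : R) (hϖ : φ ϖ ≠ 0)
    (hprime : (Ideal.span {φ ϖ}).IsPrime)
    (hdiv : ∀ a b, φ a ∣ φ b → a ∣ b) (hperf : ∀ z : R, ∃ y, ϖ ∣ y ^ p - z) (hpϖ : ϖ ∣ (p : R))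
    (π ε : R) (hπ : (p : R) = ε * π ^ (p - 1)) (α : R) (β : S) (hβ : β ^ p = φ α) (n : ℕ)
    (hn : ϖ ^ n ∣ π) : ∃ x w, β = φ x + φ ϖ ^ n * w := by
  induction n with
  | zero => exact ⟨0, β, by simp⟩
  | succ n ih =>
    obtain ⟨x, w, h⟩ := ih ((pow_dvd_pow _ n.le_succ).trans hn)
    obtain ⟨u, hu⟩ := hn
    obtain ⟨r, hr⟩ := exists_add_pow_prime_eq hp (φ x) (φ ϖ ^ n * w)
    obtain ⟨m, rfl⟩ : ∃ m, p = m + 2 := ⟨p - 2, by have := hp.two_le; omega⟩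
    have h2 : m + 2 - 1 = m + 1 := by omega
    set s : S := φ ε * φ u ^ (m + 1) * φ ϖ ^ m * φ x * w * r with hs
    have h1 : φ (α - x ^ (m + 2)) = φ (ϖ ^ (n * (m + 2))) * (w ^ (m + 2) + φ ϖ * s) := by
      have hp' : ((m + 2 : ℕ) : S) = φ ε * (φ ϖ ^ (n + 1) * φ u) ^ (m + 1) := by
        rw [← map_natCast φ, hπ, hu, h2]; simp
      rw [map_sub, ← hβ, h, hr, hp', map_pow, map_pow, hs]
      ring
    obtain ⟨z, hz⟩ := hdiv _ _ ⟨_, h1⟩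
    have h3 : φ z = w ^ (m + 2) + φ ϖ * s := by
      rw [hz, map_mul] at h1
      exact mul_left_cancel₀ (by rw [map_pow]; exact pow_ne_zero _ hϖ) h1
    obtain ⟨y, hy⟩ := hperf z
    have hmem : w - φ y ∈ Ideal.span {φ ϖ} := by
      refine sub_mem_of_pow_sub_pow_mem hp _ ?_ ?_
      · rw [Ideal.mem_span_singleton, ← map_natCast φ]
        exact map_dvd φ hpϖ
      · rw [Ideal.mem_span_singleton]
        have h4 := map_dvd φ hy
        rw [map_sub, h3, map_pow] at h4
        obtain ⟨t, ht⟩ := h4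
        exact ⟨-t - s, by linear_combination -ht⟩
    obtain ⟨v, hv⟩ := Ideal.mem_span_singleton.1 hmem
    refine ⟨x + ϖ ^ n * y, v, ?_⟩
    rw [h, sub_eq_iff_eq_add.1 hv, map_add, map_mul, map_pow]
    ring

lemma exists_prod_one_add_mul {ι R : Type*} [CommRing R] (s : Finset ι) (a : R) (f : ι → R) :
    ∃ c, ∏ i ∈ s, (1 + a * f i) = 1 + a * c := by
  have : a ∣ ∏ i ∈ s, (1 + a * f i) - 1 := by
    rw [← Ideal.mem_span_singleton, ← Ideal.Quotient.eq, map_prod, map_one]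
    refine Finset.prod_eq_one fun i _ => ?_
    rw [← map_one (Ideal.Quotient.mk _), Ideal.Quotient.eq, Ideal.mem_span_singleton]
    exact ⟨f i, by ring⟩
  obtain ⟨c, hc⟩ := this
  exact ⟨c, by rw [← hc]; ring⟩

open Polynomial in
/-- The polynomial `((1 + π X) ^ p - 1) / π ^ p - d`, with its derivative. -/
lemma exists_monic_polynomial {R : Type*} [CommRing R] [IsDomain R] {p : ℕ} (hp : p.Prime)
    {π ε : R} (hπ : (p : R) = ε * π ^ (p - 1)) (hπ0 : π ≠ 0) (d : R) :
    ∃ g : R[X], g.Monic ∧ C (π ^ p) * g = (1 + C π * X) ^ p - C (1 + π ^ p * d) ∧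
      derivative g = C ε * (1 + C π * X) ^ (p - 1) := by
  obtain ⟨c, hc⟩ := exists_add_mul_pow_eq (R := R[X]) hp (π := C π) (ε := C ε)
    (by rw [← C_pow, ← C_mul, ← hπ, C_eq_natCast]) 1 X
  have hg : C (π ^ p) * (c - C d) = (1 + C π * X) ^ p - C (1 + π ^ p * d) := by
    rw [hc]; simp; ring
  have hlin : (1 + C π * X : R[X]).natDegree = 1 := by
    rw [add_comm, ← C_1, natDegree_linear hπ0]
  have hnd : ((1 + C π * X : R[X]) ^ p).natDegree = p := by
    rw [natDegree_pow, hlin, mul_one]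
  refine ⟨c - C d, ?_, hg, ?_⟩
  · have h1 := congrArg leadingCoeff hg
    rw [leadingCoeff_mul, leadingCoeff_C, sub_eq_add_neg _ (C (1 + π ^ p * d)), ← C_neg,
      leadingCoeff_add_of_degree_lt', leadingCoeff_pow] at h1
    · have h2 : (1 + C π * X : R[X]).leadingCoeff = π := by
        rw [leadingCoeff, hlin]; simp [coeff_one]
      rw [h2] at h1
      exact mul_left_cancel₀ (pow_ne_zero p hπ0) (h1.trans (mul_one _).symm)
    · refine degree_C_le.trans_lt ?_
      rw [← natDegree_pos_iff_degree_pos, hnd]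
      exact hp.pos
  · have h1 := congrArg derivative hg
    refine mul_left_cancel₀ (C_ne_zero.2 (pow_ne_zero p hπ0)) ?_
    rw [derivative_mul, derivative_C, zero_mul, zero_add] at h1
    rw [h1, derivative_sub, derivative_C, derivative_pow, hπ]
    obtain ⟨n, rfl⟩ : ∃ n, p = n + 1 := ⟨p - 1, by have := hp.pos; omega⟩
    simp
    ring

section Local

variable (p : ℕ) [Fact p.Prime] (K : Type) [Field K] [Algebra ℚ_[p] K]
  [FiniteDimensional ℚ_[p] K]

lemma isIntegral_iff_spectralNorm_le_one (x : K) :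
    IsIntegral ℤ_[p] x ↔ spectralNorm ℚ_[p] K x ≤ 1 := by
  have hx : IsIntegral ℚ_[p] x := Algebra.IsIntegral.isIntegral x
  rw [spectralNorm, spectralValue_le_one_iff (minpoly.monic hx)]
  constructor
  · intro h n
    rw [minpoly.isIntegrallyClosed_eq_field_fractions' ℚ_[p] h, Polynomial.coeff_map]
    exact PadicInt.norm_le_one _
  · intro h
    have hl : minpoly ℚ_[p] x ∈ Polynomial.lifts (algebraMap ℤ_[p] ℚ_[p]) := by
      rw [Polynomial.lifts_iff_coeff_lifts]
      exact fun n => ⟨⟨_, h n⟩, rfl⟩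
    obtain ⟨q, hq, -, hm⟩ := Polynomial.lifts_and_natDegree_eq_and_monic hl (minpoly.monic hx)
    refine ⟨q, hm, ?_⟩
    rw [IsScalarTower.algebraMap_eq ℤ_[p] ℚ_[p] K, ← Polynomial.eval₂_map, hq]
    exact minpoly.aeval _ _

instance isLocalRing_integers : IsLocalRing (O p K) := by
  have hmul : ∀ x y : K, spectralNorm ℚ_[p] K (x * y) =
      spectralNorm ℚ_[p] K x * spectralNorm ℚ_[p] K y := spectralAlgNorm_mul
  have h1 : spectralNorm ℚ_[p] K 1 = 1 := spectralNorm_one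
  have hunit : ∀ a : O p K, spectralNorm ℚ_[p] K a = 1 → IsUnit a := by
    intro a ha
    have ha0 : (a : K) ≠ 0 := by
      intro h
      rw [h, spectralNorm_zero] at ha
      exact zero_ne_one ha
    have hinv : spectralNorm ℚ_[p] K (a : K)⁻¹ = 1 := by
      have := hmul a (a : K)⁻¹
      rwa [mul_inv_cancel₀ ha0, h1, ha, one_mul, eq_comm] at this
    exact IsUnit.of_mul_eq_one ⟨(a : K)⁻¹, (isIntegral_iff_spectralNorm_le_one p K _).2 hinv.le⟩
      (Subtype.ext (mul_inv_cancel₀ ha0))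
  refine IsLocalRing.of_isUnit_or_isUnit_one_sub_self fun a => ?_
  have ha := (isIntegral_iff_spectralNorm_le_one p K _).1 a.2
  have hb := (isIntegral_iff_spectralNorm_le_one p K _).1 (1 - a).2
  have h := isNonarchimedean_spectralNorm (K := ℚ_[p]) (L := K) (a : K) ((1 - a : O p K) : K)
  have : (a : K) + ((1 - a : O p K) : K) = 1 := by simp
  rw [this, h1, le_max_iff] at h
  exact h.imp (fun h => hunit _ (le_antisymm ha h)) (fun h => hunit _ (le_antisymm hb h))

lemma maxIdeal_eq_maximalIdeal : maxIdeal p K = IsLocalRing.maximalIdeal (O p K) :=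
  IsLocalRing.jacobson_eq_maximalIdeal _ bot_ne_top

instance moduleFinite_integers : Module.Finite ℤ_[p] (O p K) :=
  IsIntegralClosure.finite ℤ_[p] ℚ_[p] K (O p K)

instance isDedekindDomain_integers : IsDedekindDomain (O p K) :=
  integralClosure.isDedekindDomain ℤ_[p] ℚ_[p] K

instance isFractionRing_integers : IsFractionRing (O p K) K :=
  IsIntegralClosure.isFractionRing_of_finite_extension ℤ_[p] ℚ_[p] K (O p K)

instance faithfulSMul_integers : FaithfulSMul ℤ_[p] (O p K) := by
  rw [faithfulSMul_iff_algebraMap_injective]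
  refine Function.Injective.of_comp (f := algebraMap (O p K) K) ?_
  rw [← RingHom.coe_comp, ← IsScalarTower.algebraMap_eq,
    IsScalarTower.algebraMap_eq ℤ_[p] ℚ_[p] K]
  exact (algebraMap ℚ_[p] K).injective.comp (IsFractionRing.injective ℤ_[p] ℚ_[p])

instance charZero_integers : CharZero (O p K) :=
  charZero_of_injective_algebraMap (FaithfulSMul.algebraMap_injective ℤ_[p] (O p K))

lemma natCast_mem_maximalIdeal : (p : O p K) ∈ IsLocalRing.maximalIdeal (O p K) := by
  have h : (p : ℤ_[p]) ∈ IsLocalRing.maximalIdeal ℤ_[p] := by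
    rw [PadicInt.maximalIdeal_eq_span_p]
    exact Ideal.mem_span_singleton_self _
  rw [← map_natCast (algebraMap ℤ_[p] (O p K))]
  exact (((IsLocalRing.local_hom_TFAE (algebraMap ℤ_[p] (O p K))).out 0 2 rfl rfl).1 inferInstance)
    (Ideal.mem_map_of_mem _ h)

instance isDiscreteValuationRing_integers : IsDiscreteValuationRing (O p K) := by
  have : ¬ IsField (O p K) := by
    rw [IsLocalRing.isField_iff_maximalIdeal_eq]
    intro h
    have := natCast_mem_maximalIdeal p K
    rw [h, Ideal.mem_bot] at this
    exact (Fact.out : p.Prime).ne_zero (Nat.cast_eq_zero.1 this)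
  have h := (IsDiscreteValuationRing.TFAE (O p K) this).out 0 2
  exact h.2 inferInstance

lemma exists_pow_sub_mem_maximalIdeal (z : O p K) :
    ∃ y, y ^ p - z ∈ IsLocalRing.maximalIdeal (O p K) := by
  have : Finite (IsLocalRing.ResidueField ℤ_[p]) :=
    Finite.of_equiv _ (PadicInt.residueField (p := p)).toEquiv.symm
  have : Finite (IsLocalRing.ResidueField (O p K)) :=
    Module.finite_of_finite (IsLocalRing.ResidueField ℤ_[p])
  have : CharP (IsLocalRing.ResidueField (O p K)) p := by
    refine (CharP.charP_iff_prime_eq_zero Fact.out).2 ?_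
    rw [← map_natCast (IsLocalRing.residue (O p K)), IsLocalRing.residue_eq_zero_iff]
    exact natCast_mem_maximalIdeal p K
  obtain ⟨y, hy⟩ := (PerfectRing.bijective_frobenius (R := IsLocalRing.ResidueField (O p K))
    (p := p)).2 (IsLocalRing.residue _ z)
  obtain ⟨y, rfl⟩ := IsLocalRing.residue_surjective y
  refine ⟨y, ?_⟩
  rw [← IsLocalRing.residue_eq_zero_iff, map_sub, map_pow, ← hy]
  exact sub_self _

omit [FiniteDimensional ℚ_[p] K] in
variable {p K} in
lemma isIntegralUnit_iff {x : K} :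
    IsIntegralUnit p K x ↔ IsIntegral ℤ_[p] x ∧ IsIntegral ℤ_[p] x⁻¹ ∧ x ≠ 0 := by
  constructor
  · rintro ⟨u, rfl⟩
    have h : ((u : O p K) : K) * ((u⁻¹ : (O p K)ˣ) : O p K) = 1 := by
      rw [← MulMemClass.coe_mul, Units.mul_inv]; rfl
    refine ⟨u.1.2, ?_, left_ne_zero_of_mul_eq_one h⟩
    rw [inv_eq_of_mul_eq_one_right h]
    exact (u⁻¹).1.2
  · rintro ⟨h1, h2, h0⟩
    exact ⟨⟨⟨x, h1⟩, ⟨x⁻¹, h2⟩, Subtype.ext (mul_inv_cancel₀ h0),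
      Subtype.ext (inv_mul_cancel₀ h0)⟩, rfl⟩

end Local

open Polynomial in
lemma formallyUnramified_of_adjoin_eq_top {A B : Type*} [CommRing A] [CommRing B] [Algebra A B]
    (x : B) (hx : Algebra.adjoin A {x} = ⊤) (f : A[X]) (hf : aeval x f = 0)
    (hf' : IsUnit (aeval x (derivative f))) : Algebra.FormallyUnramified A B := by
  have hD : KaehlerDifferential.D A B x = 0 := by
    have h := congrArg (KaehlerDifferential.D A B) hf
    rw [Derivation.map_aeval, map_zero] at h
    exact hf'.smul_eq_zero.1 h
  refine ⟨⟨fun a b => ?_⟩⟩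
  have : (⊤ : Submodule B (Ω[B⁄A])) ≤ ⊥ := by
    rw [← KaehlerDifferential.span_range_derivation, Submodule.span_le]
    rintro _ ⟨b, rfl⟩
    have hb : b ∈ Algebra.adjoin A {x} := hx ▸ Algebra.mem_top
    obtain ⟨q, rfl⟩ := Algebra.adjoin_singleton_eq_range_aeval A x ▸ hb
    simp [Derivation.map_aeval, hD]
  rw [(Submodule.mem_bot B).1 (this (Submodule.mem_top (x := a))),
    (Submodule.mem_bot B).1 (this (Submodule.mem_top (x := b)))]

section Extension

variable {p : ℕ} [Fact p.Prime] {K L : Type} [Field K] [Field L] [Algebra ℚ_[p] K]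
  [Algebra ℚ_[p] L] [Algebra K L] [IsScalarTower ℚ_[p] K L] [FiniteDimensional ℚ_[p] K]
  [FiniteDimensional ℚ_[p] L]

omit [FiniteDimensional ℚ_[p] K] [FiniteDimensional ℚ_[p] L] in
lemma intMap_injective : Function.Injective (intMap p K L) := fun _ _ h =>
  Subtype.ext ((algebraMap K L).injective (congrArg Subtype.val h))

omit [FiniteDimensional ℚ_[p] K] [FiniteDimensional ℚ_[p] L] in
lemma dvd_of_intMap_dvd {a b : O p K} (h : intMap p K L a ∣ intMap p K L b) : a ∣ b := by
  by_cases ha : a = 0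
  · subst ha
    rw [map_zero, zero_dvd_iff, map_eq_zero_iff _ intMap_injective] at h
    rw [h]
  obtain ⟨c, hc⟩ := h
  have ha' : (a : K) ≠ 0 := fun h => ha (Subtype.ext h)
  have hc' : algebraMap K L b = algebraMap K L a * c := congrArg Subtype.val hc
  have hc'' : algebraMap K L (b / a) = c := by
    rw [map_div₀, hc', mul_div_cancel_left₀ _ (by simpa using ha')]
  have hyint : IsIntegral ℤ_[p] ((b : K) / a) := by
    rw [← isIntegral_algebraMap_iff (algebraMap K L).injective, hc'']
    exact c.2
  exact ⟨⟨_, hyint⟩, Subtype.ext (mul_div_cancel₀ _ ha').symm⟩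

open Polynomial in
lemma isUnramifiedExt_of_isUnit_derivative (y : O p L) (hy : Algebra.adjoin K {(y : L)} = ⊤)
    (g : (O p K)[X]) (hgm : g.Monic) (hg : g.eval₂ (intMap p K L) y = 0)
    (hg' : IsUnit ((derivative g).eval₂ (intMap p K L) y)) : IsUnramifiedExt p K L := by
  let : Algebra (O p K) (O p L) := (intMap p K L).toAlgebra
  have : IsScalarTower (O p K) (O p L) L := IsScalarTower.of_algebraMap_eq fun _ => rfl
  have : IsScalarTower ℤ_[p] (O p K) (O p L) := IsScalarTower.of_algebraMap_eq fun a =>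
    Subtype.ext (IsScalarTower.algebraMap_apply ℤ_[p] K L a)
  have : FiniteDimensional K L := FiniteDimensional.right ℚ_[p] K L
  have : CharZero K := charZero_of_injective_algebraMap (algebraMap ℚ_[p] K).injective
  have : IsIntegralClosure (O p L) (O p K) L := IsIntegralClosure.tower_top (R := ℤ_[p])
  have : Module.Finite (O p K) (O p L) := Module.Finite.of_restrictScalars_finite ℤ_[p] _ _
  have : FaithfulSMul (O p K) (O p L) :=
    (faithfulSMul_iff_algebraMap_injective _ _).2 intMap_injective
  have hyint : IsIntegral (O p K) y := ⟨g, hgm, hg⟩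
  obtain ⟨q, hq⟩ := minpoly.isIntegrallyClosed_dvd hyint (p := g) hg
  have hm : IsUnit (aeval y (derivative (minpoly (O p K) y))) := by
    rw [hq] at hg'
    change IsUnit (aeval y (derivative _)) at hg'
    rw [derivative_mul, map_add, map_mul, map_mul, minpoly.aeval, zero_mul, add_zero] at hg'
    exact isUnit_of_mul_isUnit_left hg'
  have hcond := conductor_mul_differentIdeal (O p K) K L y hy
  rw [Ideal.span_singleton_eq_top.2 hm] at hcond
  have htop : conductor (O p K) y = ⊤ := top_le_iff.1 (hcond.ge.trans Ideal.mul_le_left)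
  have : Algebra.FormallyUnramified (O p K) (O p L) :=
    formallyUnramified_of_adjoin_eq_top y (adjoin_eq_top_of_conductor_eq_top htop) _
      (minpoly.aeval _ _) hm
  rw [IsUnramifiedExt, maxIdeal_eq_maximalIdeal, maxIdeal_eq_maximalIdeal]
  exact Algebra.FormallyUnramified.map_maximalIdeal (R := O p K) (S := O p L)

omit [FiniteDimensional ℚ_[p] K] in
lemma ne_zero_of_natCast_eq {π ε : O p K} (hπ : (p : O p K) = ε * π ^ (p - 1)) : π ≠ 0 := by
  have hp : p.Prime := Fact.out
  rintro rfl
  rw [zero_pow (by have := hp.two_le; omega), mul_zero, Nat.cast_eq_zero] at hπ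
  exact hp.ne_zero hπ

/-- A unit with a `p`-th root in an unramified extension is a `p`-th power modulo `(ζ - 1) ^ p`. -/
lemma exists_eq_pow_add_of_isUnramifiedExt (hur : IsUnramifiedExt p K L) {π ε : O p K}
    (hπ : (p : O p K) = ε * π ^ (p - 1)) (α : O p K) (β : O p L) (hβ : β ^ p = intMap p K L α) :
    ∃ x c, α = x ^ p + π ^ p * c := by
  have hp : p.Prime := Fact.out
  obtain ⟨ϖ, hϖ⟩ := IsDiscreteValuationRing.exists_irreducible (O p K)
  have hmK : IsLocalRing.maximalIdeal (O p K) = Ideal.span {ϖ} := hϖ.maximalIdeal_eq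
  have hmL : Ideal.span {intMap p K L ϖ} = IsLocalRing.maximalIdeal (O p L) := by
    rw [IsUnramifiedExt, maxIdeal_eq_maximalIdeal, maxIdeal_eq_maximalIdeal, hmK,
      Ideal.map_span, Set.image_singleton] at hur
    exact hur
  have hπ0 := ne_zero_of_natCast_eq hπ
  obtain ⟨n, hn⟩ := IsDiscreteValuationRing.associated_pow_irreducible hπ0 hϖ
  obtain ⟨x, w, h⟩ := exists_eq_add_mul_of_pow_eq (intMap p K L) hp ϖ
    ((map_ne_zero_iff _ intMap_injective).2 hϖ.ne_zero) (hmL ▸ inferInstance)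
    (fun _ _ => dvd_of_intMap_dvd)
    (fun z => by
      obtain ⟨y, hy⟩ := exists_pow_sub_mem_maximalIdeal p K z
      exact ⟨y, Ideal.mem_span_singleton.1 (hmK ▸ hy)⟩)
    (Ideal.mem_span_singleton.1 (hmK ▸ natCast_mem_maximalIdeal p K)) π ε hπ α β hβ n hn.symm.dvd
  obtain ⟨u, hu⟩ := hn
  obtain ⟨c, hc⟩ := exists_add_mul_pow_eq hp (π := intMap p K L π) (ε := intMap p K L ε)
    (by rw [← map_natCast (intMap p K L), hπ, map_mul, map_pow]) (intMap p K L x)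
    (intMap p K L u * w)
  have hdvd : π ^ p ∣ α - x ^ p := by
    refine dvd_of_intMap_dvd (L := L) ⟨c, ?_⟩
    rw [map_sub, ← hβ, h, ← map_pow, ← hu, map_mul, mul_assoc]
    rw [hc, map_pow, map_pow, add_sub_cancel_left]
  obtain ⟨c, hc⟩ := hdvd
  exact ⟨x, c, by rw [← hc]; ring⟩

end Extension

section Norm

variable {p : ℕ} [Fact p.Prime] {F E : Type} [Field F] [Field E] [Algebra ℚ_[p] F]
  [Algebra ℚ_[p] E] [Algebra F E] [IsScalarTower ℚ_[p] F E] [FiniteDimensional ℚ_[p] F]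
  [FiniteDimensional ℚ_[p] E]

omit [FiniteDimensional ℚ_[p] F] in
lemma exists_norm_one_add_mul {a : O p F} (ha : a ≠ 0) (c : O p E) :
    ∃ d : O p F, Algebra.norm F (1 + algebraMap F E a * c) = 1 + a * d := by
  have : FiniteDimensional F E := FiniteDimensional.right ℚ_[p] F E
  have : CharZero F := charZero_of_injective_algebraMap (algebraMap ℚ_[p] F).injective
  let Ω := AlgebraicClosure F
  have ha' : (a : F) ≠ 0 := fun h => ha (Subtype.ext h)
  obtain ⟨e, he⟩ := exists_prod_one_add_mul (Finset.univ : Finset (E →ₐ[F] Ω))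
    (intMap p F Ω a)
    (fun σ => ⟨σ c, IsIntegral.map (σ.restrictScalars ℤ_[p]) c.2⟩)
  have he' := congrArg Subtype.val he
  have h1 : algebraMap F Ω (Algebra.norm F (1 + algebraMap F E a * c)) =
      1 + algebraMap F Ω a * e := by
    rw [Algebra.norm_eq_prod_embeddings]
    refine Eq.trans ?_ he'
    rw [SubmonoidClass.coe_finsetProd]
    refine Finset.prod_congr rfl fun σ _ => ?_
    rw [map_add, map_one, map_mul, AlgHom.commutes]
    rfl
  have h2 : algebraMap F Ω ((Algebra.norm F (1 + algebraMap F E a * c) - 1) / a) = e := by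
    rw [map_div₀, map_sub, h1, map_one, add_sub_cancel_left,
      mul_div_cancel_left₀ _ (by simpa using ha')]
  refine ⟨⟨(Algebra.norm F (1 + algebraMap F E a * c) - 1) / a, ?_⟩, ?_⟩
  · change IsIntegral ℤ_[p] _
    rw [← isIntegral_algebraMap_iff (algebraMap F Ω).injective, h2]
    exact e.2
  · rw [mul_div_cancel₀ _ ha', add_sub_cancel]

omit [FiniteDimensional ℚ_[p] F] in
lemma IsIntegralUnit.norm {α : E} (hα : IsIntegralUnit p E α) :
    IsIntegralUnit p F (Algebra.norm F α) := by
  have : FiniteDimensional F E := FiniteDimensional.right ℚ_[p] F E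
  have : CharZero F := charZero_of_injective_algebraMap (algebraMap ℚ_[p] F).injective
  rw [isIntegralUnit_iff] at hα ⊢
  obtain ⟨h1, h2, h0⟩ := hα
  refine ⟨Algebra.isIntegral_norm F h1, ?_, Algebra.norm_ne_zero_iff.2 h0⟩
  rw [inv_eq_of_mul_eq_one_right (by rw [← map_mul, mul_inv_cancel₀ h0, map_one] :
    Algebra.norm F α * Algebra.norm F α⁻¹ = 1)]
  exact Algebra.isIntegral_norm F h2

end Norm

section Kummer

variable {p : ℕ} [Fact p.Prime] {K L : Type} [Field K] [Field L] [Algebra ℚ_[p] K]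
  [Algebra ℚ_[p] L] [Algebra K L] [IsScalarTower ℚ_[p] K L] [FiniteDimensional ℚ_[p] K]
  [FiniteDimensional ℚ_[p] L]

lemma mem_maximalIdeal_of_natCast_eq {π ε : O p K} (hπ : (p : O p K) = ε * π ^ (p - 1))
    (hε : IsUnit ε) : π ∈ IsLocalRing.maximalIdeal (O p K) := by
  have h := natCast_mem_maximalIdeal p K
  rw [hπ] at h
  refine Ideal.IsPrime.mem_of_pow_mem inferInstance (p - 1)
    ((Ideal.IsPrime.mem_or_mem inferInstance h).resolve_left fun h => ?_)
  exact (IsLocalRing.mem_maximalIdeal _).1 h hε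

lemma isUnit_one_add_pow_mul {π : O p K} (hπ : π ∈ IsLocalRing.maximalIdeal (O p K))
    (d : O p K) : IsUnit (1 + π ^ p * d) := by
  have hp : p.Prime := Fact.out
  have h : -(π ^ p * d) ∈ nonunits (O p K) := (IsLocalRing.mem_maximalIdeal _).1
    (neg_mem (Ideal.mul_mem_right _ _ (Ideal.pow_mem_of_mem _ hπ _ hp.pos)))
  simpa using IsLocalRing.isUnit_one_sub_self_of_mem_nonunits _ h

open Polynomial in
lemma isUnramifiedExt_of_pow_eq {π ε : O p K} (hπ : (p : O p K) = ε * π ^ (p - 1))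
    (hε : IsUnit ε) (d : O p K) (z : L) (hz : Algebra.adjoin K {z} = ⊤)
    (h : (1 + algebraMap K L π * z) ^ p = algebraMap K L (1 + π ^ p * d)) :
    IsUnramifiedExt p K L := by
  have hp : p.Prime := Fact.out
  have hπ0 := ne_zero_of_natCast_eq hπ
  obtain ⟨g, hgm, hg, hg'⟩ := exists_monic_polynomial hp hπ hπ0 d
  have hgz : aeval z g = 0 := by
    have h1 := congrArg (aeval z) hg
    rw [map_mul, aeval_C, map_sub, map_pow (aeval z), map_add, map_one, map_mul, aeval_C, aeval_C,
      aeval_X] at h1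
    have h2 : ∀ a : O p K, algebraMap (O p K) L a = algebraMap K L a := fun _ => rfl
    have h3 : ((1 + π ^ p * d : O p K) : K) = 1 + (π : K) ^ p * d := rfl
    rw [h2, h2, h2, h, h3, sub_self] at h1
    exact (mul_eq_zero.1 h1).resolve_left fun h0 => pow_ne_zero p hπ0
      (Subtype.ext ((algebraMap K L).injective (h0.trans (map_zero _).symm)))
  have hzint : IsIntegral ℤ_[p] z := by
    have : IsIntegral (O p K) z := ⟨g, hgm, hgz⟩
    exact isIntegral_trans z this
  let y : O p L := ⟨z, hzint⟩
  have hunit : IsUnit (1 + intMap p K L π * y) := by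
    refine (isUnit_pow_iff hp.ne_zero).1 ?_
    have : (1 + intMap p K L π * y) ^ p = intMap p K L (1 + π ^ p * d) :=
      Subtype.ext h
    rw [this]
    exact (isUnit_one_add_pow_mul (mem_maximalIdeal_of_natCast_eq hπ hε) d).map _
  refine isUnramifiedExt_of_isUnit_derivative y hz g hgm ?_ ?_
  · refine Subtype.ext (Eq.trans ?_ hgz)
    exact (hom_eval₂ g (intMap p K L) (algebraMap (O p L) L) y).trans rfl
  · rw [hg']
    simp only [eval₂_mul, eval₂_C, eval₂_pow, eval₂_add, eval₂_one, eval₂_X]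
    exact (hε.map _).mul (hunit.pow _)

open IntermediateField in
lemma nonempty_unramifiedRootWitness {π ε : O p K} (hπ : (p : O p K) = ε * π ^ (p - 1))
    (hε : IsUnit ε) (d : O p K) (x : K) :
    Nonempty (UnramifiedRootWitness p K p (x ^ p * (1 + (π : K) ^ p * d))) := by
  have hp : p.Prime := Fact.out
  have hπ0 : (π : K) ≠ 0 := fun h => ne_zero_of_natCast_eq hπ (Subtype.ext h)
  obtain ⟨η, hη⟩ := IsAlgClosed.exists_pow_nat_eq
    (algebraMap K (AlgebraicClosure K) (1 + (π : K) ^ p * d)) hp.pos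
  let z : AlgebraicClosure K := (η - 1) / algebraMap K _ π
  have hzint : IsIntegral K z := Algebra.IsIntegral.isIntegral z
  have : FiniteDimensional K K⟮z⟯ := adjoin.finiteDimensional hzint
  have : FiniteDimensional ℚ_[p] K⟮z⟯ := FiniteDimensional.trans ℚ_[p] K K⟮z⟯
  have hgen : Algebra.adjoin K {AdjoinSimple.gen K z} = ⊤ := by
    rw [← adjoin.powerBasis_gen hzint]
    exact PowerBasis.adjoin_gen_eq_top _
  have hroot : (1 + algebraMap K K⟮z⟯ π * AdjoinSimple.gen K z) ^ p =
      algebraMap K K⟮z⟯ (1 + (π : K) ^ p * d) := by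
    refine Subtype.ext (Eq.trans ?_ hη)
    change (1 + algebraMap K (AlgebraicClosure K) π * z) ^ p = η ^ p
    rw [mul_div_cancel₀ _ (by simpa using hπ0), add_sub_cancel]
  exact ⟨{
    L := K⟮z⟯
    β := algebraMap K K⟮z⟯ x * (1 + algebraMap K K⟮z⟯ π * AdjoinSimple.gen K z)
    pow_eq := by rw [mul_pow, hroot, map_mul, map_pow]
    unram := isUnramifiedExt_of_pow_eq hπ hε d _ hgen hroot }⟩

end Kummer

end PadicStmt

open PadicStmt in
/-- Let `E/F` be a finite extension of `p`-adic fields such that `F`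
contains a primitive `p`-th root of unity.  If `α` is a `p`-primary unit of `E`, then
`N_{E/F}(α)` is a `p`-primary unit of `F`. -/
theorem stmt6 (p : ℕ) [Fact p.Prime] (F E : Type) [Field F] [Field E]
    [Algebra ℚ_[p] F] [Algebra ℚ_[p] E] [Algebra F E] [IsScalarTower ℚ_[p] F E]
    [FiniteDimensional ℚ_[p] F] [FiniteDimensional ℚ_[p] E]
    (ζ : F) (hζ : IsPrimitiveRoot ζ p)
    (α : E) (hα : IsPPrimary p E α) :
    IsPPrimary p F (Algebra.norm F α) := by
  have hp : p.Prime := Fact.out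
  refine ⟨hα.1.norm, ?_⟩
  obtain ⟨⟨u, rfl⟩, ⟨W⟩⟩ := hα
  obtain ⟨L, β, hβ, hur⟩ := W
  have hζ' : IsPrimitiveRoot (⟨ζ, (hζ.isIntegral hp.pos).tower_top⟩ : O p F) p :=
    IsPrimitiveRoot.of_map_of_injective (f := algebraMap (O p F) F) hζ Subtype.val_injective
  obtain ⟨ε, hε⟩ := exists_unit_mul_sub_one_pow hp hζ'
  set π : O p F := ⟨ζ, (hζ.isIntegral hp.pos).tower_top⟩ - 1 with hπ
  have hεE : (p : O p E) = intMap p F E ε * intMap p F E π ^ (p - 1) := by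
    rw [← map_natCast (intMap p F E), hε, map_mul, map_pow]
  have hβint : IsIntegral ℤ_[p] β := by
    refine IsIntegral.of_pow hp.pos ?_
    rw [hβ]
    exact (intMap p E L u).2
  obtain ⟨x, c, hxc⟩ := exists_eq_pow_add_of_isUnramifiedExt hur hεE u ⟨β, hβint⟩
    (Subtype.ext hβ)
  have hπE := mem_maximalIdeal_of_natCast_eq hεE (ε.isUnit.map _)
  have hx : IsUnit x := by
    refine (isUnit_pow_iff hp.ne_zero).1 ?_
    have h1 : x ^ p = u * (1 + intMap p F E π ^ p * (-c * ((u⁻¹ : (O p E)ˣ) : O p E))) := by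
      linear_combination (-1 : O p E) * hxc + (intMap p F E π ^ p * c) * u.mul_inv
    rw [h1]
    exact u.isUnit.mul (isUnit_one_add_pow_mul hπE _)
  obtain ⟨v, rfl⟩ := hx
  have hu : (u : O p E) = v ^ p *
      (1 + intMap p F E (π ^ p) * (c * ((v⁻¹ : (O p E)ˣ) : O p E) ^ p)) := by
    rw [hxc, map_pow]
    have h2 : (v : O p E) ^ p * ((v⁻¹ : (O p E)ˣ) : O p E) ^ p = 1 := by
      rw [← mul_pow, Units.mul_inv, one_pow]
    linear_combination (-(intMap p F E π ^ p * c)) * h2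
  obtain ⟨d, hd⟩ := exists_norm_one_add_mul (E := E) (pow_ne_zero p (ne_zero_of_natCast_eq hε))
    (c * ((v⁻¹ : (O p E)ˣ) : O p E) ^ p)
  have hnorm : Algebra.norm F ((u : O p E) : E) =
      Algebra.norm F ((v : O p E) : E) ^ p * (1 + (π : F) ^ p * d) := by
    rw [congrArg Subtype.val hu, ← map_pow]
    exact (map_mul _ _ _).trans (congrArg _ hd)
  rw [hnorm]
  exact nonempty_unramifiedRootWitness hε ε.isUnit d _
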